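/- (Theorem 2, iterative precedence implies precedence) Let a = ⟨c_s, c_{a_1},…,c_{a_k}⟩ and b = ⟨c_s, c_{b_1},…,c_{b_k}⟩ (k ≥ 0) be two point sequences with the same source point c_s, pick-up probabilities P, distances D, and constant D∞. Let c_0 be any starting point and c_1,…,c_m (m ≥ 0) any common prefix, giving routes d_a = ⟨c_0, c_1,…,c_m, c_s, c_{a_1},…,c_{a_k}⟩ and d_b = ⟨c_0, c_1,…,c_m, c_s, c_{b_1},…,c_{b_k}⟩. Let D_0 = D_{c_0,c_1} + Σ_{i=1}^{m−1} D_{c_i,c_{i+1}} + D_{c_m,c_s}. Assume P(c_i) < 1 for all prefix points c_i (1 ≤ i ≤ m), P(c_i) ≤ 1 for those points, P(c_s) < 1, and D∞ > D_0. If either (F1(a) ≤ F1(b) and 1 − PE(a) < 1 − PE(b)) or (F1(a) < F1(b) and 1 − PE(a) ≤ 1 − PE(b)), where PE(a) = PE(P(c_s),P(c_{a_1}),…,P(c_{a_k})) and PE(b) = PE(P(c_s),P(c_{b_1}),…,P(c_{b_k})), then F(d_a) < F(d_b). -/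

import Mathlib

/-- The probability summation function `PE(p_1,…,p_L) = Σ_{k=1}^{L} (∏_{i=1}^{k−1}(1−p_i))·p_k`
(written with 0-based indices: `p 0, …, p (L-1)`); the empty product equals 1. -/
noncomputable def PE (L : ℕ) (p : ℕ → ℝ) : ℝ :=
  ∑ k ∈ Finset.range L, (∏ i ∈ Finset.range k, (1 - p i)) * p k

/-- The PTD sub-function of a sequence of points `c_1,…,c_L` (0-based: `c 0,…,c (L-1)`):
`F1(c_1,…,c_L) = Σ_{k=2}^{L} (Σ_{i=2}^{k} D_{c_{i−1},c_i})·(∏_{i=2}^{k−1}(1−P(c_i)))·P(c_k)`,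
with `F1(c_1) = 0` when `L = 1`. -/
noncomputable def F1seq {α : Type*} (L : ℕ) (c : ℕ → α) (P : α → ℝ) (D : α → α → ℝ) : ℝ :=
  ∑ k ∈ Finset.Ico 1 L,
    (∑ i ∈ Finset.Icc 1 k, D (c (i - 1)) (c i)) *
      ((∏ i ∈ Finset.Ico 1 k, (1 - P (c i))) * P (c k))

/-- The potential travel distance of a driving route `d = ⟨c_0, c_1,…,c_L⟩` (here `c i` is
the `i`-th point of the route, `c 0` the starting position):
`F(d) = Σ_{k=1}^{L} (Σ_{i=1}^{k} D_{c_{i−1},c_i})·(∏_{i=1}^{k−1}(1−P(c_i)))·P(c_k)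
        + D∞·∏_{i=1}^{L}(1−P(c_i))`. -/
noncomputable def Froute {α : Type*} (L : ℕ) (c : ℕ → α) (P : α → ℝ) (D : α → α → ℝ)
    (Dinf : ℝ) : ℝ :=
  (∑ k ∈ Finset.Icc 1 L,
    (∑ i ∈ Finset.Icc 1 k, D (c (i - 1)) (c i)) *
      ((∏ i ∈ Finset.Ico 1 k, (1 - P (c i))) * P (c k))) +
    Dinf * ∏ i ∈ Finset.Icc 1 L, (1 - P (c i))

/-- The route PTD sub-function of a route `⟨c_0, c_1,…,c_m⟩`:
`F1(⟨c_0,…,c_m⟩) = Σ_{k=1}^{m} (Σ_{i=1}^{k} D_{c_{i−1},c_i})·(∏_{i=1}^{k−1}(1−P(c_i)))·P(c_k)`,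
which equals 0 when `m = 0`. -/
noncomputable def F1route {α : Type*} (m : ℕ) (c : ℕ → α) (P : α → ℝ) (D : α → α → ℝ) : ℝ :=
  ∑ k ∈ Finset.Icc 1 m,
    (∑ i ∈ Finset.Icc 1 k, D (c (i - 1)) (c i)) *
      ((∏ i ∈ Finset.Ico 1 k, (1 - P (c i))) * P (c k))

/-- The sequence `⟨c_s, t_1, t_2, …⟩` (0-based: index 0 is `cs`, index `i ≥ 1` is `t (i-1)`). -/
def seqPts {α : Type*} (cs : α) (t : ℕ → α) : ℕ → α :=
  fun i => if i = 0 then cs else t (i - 1)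

/-- The route `⟨c_0, c_1,…,c_m, c_s, t_1,…⟩`: index 0 is the starting point `c0`, indices
`1,…,m` are the prefix points `pre 0,…,pre (m-1)`, index `m+1` is `cs`, and index `m+1+j`
(`j ≥ 1`) is `t (j-1)`. -/
def routePts {α : Type*} (c0 : α) (m : ℕ) (pre : ℕ → α) (cs : α) (t : ℕ → α) : ℕ → α :=
  fun i => if i = 0 then c0 else if i ≤ m then pre (i - 1)
    else if i = m + 1 then cs else t (i - m - 2)

/-- The failure probability of a sequence of independent attempts is the product of the individual
failure probabilities. -/
theorem one_sub_PE (L : ℕ) (p : ℕ → ℝ) : 1 - PE L p = ∏ i ∈ Finset.range L, (1 - p i) := by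
  induction L with
  | zero => simp [PE]
  | succ n ih =>
    rw [Finset.prod_range_succ, ← ih]
    have h : PE (n + 1) p = PE n p + (1 - PE n p) * p n := by
      rw [ih]; simp only [PE, Finset.sum_range_succ]
    rw [h]; ring

theorem sum_dist_add {α : Type*} (c : ℕ → α) (D : α → α → ℝ) (n j : ℕ) :
    ∑ i ∈ Finset.Icc 1 (n + j), D (c (i - 1)) (c i) =
      ∑ i ∈ Finset.Icc 1 n, D (c (i - 1)) (c i) +
        ∑ i ∈ Finset.Icc 1 j, D (c (n + (i - 1))) (c (n + i)) := by
  induction j with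
  | zero => simp
  | succ j ih =>
    rw [← add_assoc, Finset.sum_Icc_succ_top (by omega), ih, Finset.sum_Icc_succ_top (by omega)]
    simp only [Nat.add_sub_cancel]
    rw [← add_assoc, ← add_assoc]

theorem prod_Ico_one_add (f : ℕ → ℝ) (m j : ℕ) :
    ∏ i ∈ Finset.Ico 1 (m + 1 + j), f i =
      (∏ i ∈ Finset.Icc 1 m, f i) * ∏ i ∈ Finset.range j, f (m + 1 + i) := by
  induction j with
  | zero => simp [Finset.Ico_add_one_right_eq_Icc]
  | succ j ih =>
    rw [← add_assoc, Finset.prod_Ico_succ_top (by omega), ih, Finset.prod_range_succ, mul_assoc]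

theorem F1route_succ {α : Type*} (n : ℕ) (c : ℕ → α) (P : α → ℝ) (D : α → α → ℝ) :
    F1route (n + 1) c P D = F1route n c P D +
      (∑ i ∈ Finset.Icc 1 (n + 1), D (c (i - 1)) (c i)) *
        ((∏ i ∈ Finset.Ico 1 (n + 1), (1 - P (c i))) * P (c (n + 1))) :=
  Finset.sum_Icc_succ_top (by omega) _

theorem F1seq_succ {α : Type*} (n : ℕ) (c : ℕ → α) (P : α → ℝ) (D : α → α → ℝ) :
    F1seq (n + 2) c P D = F1seq (n + 1) c P D +
      (∑ i ∈ Finset.Icc 1 (n + 1), D (c (i - 1)) (c i)) *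
        ((∏ i ∈ Finset.Ico 1 (n + 1), (1 - P (c i))) * P (c (n + 1))) :=
  Finset.sum_Ico_succ_top (by omega) _

/-- Splitting the route sub-function at the point with index `m + 1`. -/
theorem F1route_add {α : Type*} (m k : ℕ) (c : ℕ → α) (P : α → ℝ) (D : α → α → ℝ) :
    F1route (m + 1 + k) c P D = F1route m c P D +
      (∏ i ∈ Finset.Icc 1 m, (1 - P (c i))) *
        ((∑ i ∈ Finset.Icc 1 (m + 1), D (c (i - 1)) (c i)) *
            PE (k + 1) (fun i => P (c (m + 1 + i))) +
          (1 - P (c (m + 1))) * F1seq (k + 1) (fun i => c (m + 1 + i)) P D) := by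
  induction k with
  | zero =>
    simp only [add_zero, F1route_succ, Finset.Ico_add_one_right_eq_Icc]
    simp [PE, F1seq, mul_left_comm]
  | succ k ih =>
    have hPE : PE (k + 2) (fun i => P (c (m + 1 + i))) =
        PE (k + 1) (fun i => P (c (m + 1 + i))) +
          (∏ i ∈ Finset.range (k + 1), (1 - P (c (m + 1 + i)))) * P (c (m + 1 + (k + 1))) :=
      Finset.sum_range_succ _ _
    have hprod : ∏ i ∈ Finset.range (k + 1), (1 - P (c (m + 1 + i))) =
        (1 - P (c (m + 1))) * ∏ i ∈ Finset.Ico 1 (k + 1), (1 - P (c (m + 1 + i))) := by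
      rw [Finset.range_eq_Ico, Finset.prod_eq_prod_Ico_succ_bot (by omega)]
    rw [← add_assoc, F1route_succ, ih, add_assoc (m + 1) k 1,
      sum_dist_add c D (m + 1) (k + 1), prod_Ico_one_add, F1seq_succ, hPE, hprod]
    ring

/-- The potential travel distance of a route in terms of the prefix `c_0, …, c_m` and of the
sequence starting at the point with index `m + 1`. -/
theorem Froute_add {α : Type*} (m k : ℕ) (c : ℕ → α) (P : α → ℝ) (D : α → α → ℝ) (Dinf : ℝ) :
    Froute (m + 1 + k) c P D Dinf = F1route m c P D +
      (∏ i ∈ Finset.Icc 1 m, (1 - P (c i))) *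
        ((∑ i ∈ Finset.Icc 1 (m + 1), D (c (i - 1)) (c i)) +
          (1 - P (c (m + 1))) * F1seq (k + 1) (fun i => c (m + 1 + i)) P D +
          (Dinf - ∑ i ∈ Finset.Icc 1 (m + 1), D (c (i - 1)) (c i)) *
            (1 - PE (k + 1) (fun i => P (c (m + 1 + i))))) := by
  have h : Froute (m + 1 + k) c P D Dinf = F1route (m + 1 + k) c P D +
      Dinf * ∏ i ∈ Finset.Icc 1 (m + 1 + k), (1 - P (c i)) := rfl
  rw [h, F1route_add, ← Finset.Ico_add_one_right_eq_Icc 1 (m + 1 + k), add_assoc (m + 1) k 1,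
    prod_Ico_one_add, ← one_sub_PE]
  ring

theorem routePts_prefix_congr {α : Type*} (c0 : α) (m : ℕ) (pre : ℕ → α) (cs : α) (s t : ℕ → α)
    {i : ℕ} (hi : i ≤ m + 1) : routePts c0 m pre cs s i = routePts c0 m pre cs t i := by
  unfold routePts
  split_ifs <;> first | rfl | omega

theorem routePts_suffix {α : Type*} (c0 : α) (m : ℕ) (pre : ℕ → α) (cs : α) (t : ℕ → α) (i : ℕ) :
    routePts c0 m pre cs t (m + 1 + i) = seqPts cs t i := by
  rcases i with _ | i
  · simp [routePts, seqPts]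
  · simp only [routePts, seqPts, Nat.add_sub_cancel]
    rw [if_neg (by omega), if_neg (by omega), if_neg (by omega), if_neg (by omega)]
    congr 1
    omega

theorem F1route_congr {α : Type*} {m : ℕ} {c d : ℕ → α} (P : α → ℝ) (D : α → α → ℝ)
    (h : ∀ i ≤ m, c i = d i) : F1route m c P D = F1route m d P D := by
  refine Finset.sum_congr rfl fun k hk => ?_
  rw [Finset.mem_Icc] at hk
  rw [h k hk.2]
  congr 1
  · refine Finset.sum_congr rfl fun i hi => ?_
    rw [Finset.mem_Icc] at hi
    rw [h i (by omega), h (i - 1) (by omega)]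
  · congr 1
    refine Finset.prod_congr rfl fun i hi => ?_
    rw [Finset.mem_Ico] at hi
    rw [h i (by omega)]

/-- Theorem 2, iterative precedence implies precedence: let
`a = ⟨c_s, c_{a_1},…,c_{a_k}⟩` and `b = ⟨c_s, c_{b_1},…,c_{b_k}⟩` (`k ≥ 0`) share the
source point `c_s`; for any starting point `c_0` and common prefix `c_1,…,c_m` (`m ≥ 0`),
with `D_0 = D_{c_0,c_1} + Σ_{i=1}^{m−1} D_{c_i,c_{i+1}} + D_{c_m,c_s}`, assuming
`P(c_i) < 1` and `P(c_i) ≤ 1` for the prefix points, `P(c_s) < 1` and `D∞ > D_0`: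
if `(F1(a) ≤ F1(b) ∧ 1 − PE(a) < 1 − PE(b))` or `(F1(a) < F1(b) ∧ 1 − PE(a) ≤ 1 − PE(b))`,
then `F(d_a) < F(d_b)`. -/
theorem iterative_precedence_implies_precedence {α : Type*} (m k : ℕ) (c0 cs : α)
    (pre ta tb : ℕ → α) (P : α → ℝ) (D : α → α → ℝ) (Dinf : ℝ) (D0 : ℝ)
    (hD0 : D0 = ∑ i ∈ Finset.Icc 1 (m + 1),
      D (routePts c0 m pre cs ta (i - 1)) (routePts c0 m pre cs ta i))
    (hpre_lt : ∀ i < m, P (pre i) < 1)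
    (hpre_le : ∀ i < m, P (pre i) ≤ 1)
    (hcs : P cs < 1)
    (hDinf : Dinf > D0)
    (hprec :
      (F1seq (k + 1) (seqPts cs ta) P D ≤ F1seq (k + 1) (seqPts cs tb) P D ∧
        1 - PE (k + 1) (fun i => P (seqPts cs ta i)) <
          1 - PE (k + 1) (fun i => P (seqPts cs tb i))) ∨
      (F1seq (k + 1) (seqPts cs ta) P D < F1seq (k + 1) (seqPts cs tb) P D ∧
        1 - PE (k + 1) (fun i => P (seqPts cs ta i)) ≤
          1 - PE (k + 1) (fun i => P (seqPts cs tb i)))) :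
    Froute (m + 1 + k) (routePts c0 m pre cs ta) P D Dinf <
      Froute (m + 1 + k) (routePts c0 m pre cs tb) P D Dinf := by
  have hpt : ∀ i ≤ m + 1, routePts c0 m pre cs tb i = routePts c0 m pre cs ta i :=
    fun i hi => routePts_prefix_congr c0 m pre cs tb ta hi
  have hF : F1route m (routePts c0 m pre cs tb) P D = F1route m (routePts c0 m pre cs ta) P D :=
    F1route_congr P D fun i hi => hpt i (by omega)
  have hQ : ∏ i ∈ Finset.Icc 1 m, (1 - P (routePts c0 m pre cs tb i)) =
      ∏ i ∈ Finset.Icc 1 m, (1 - P (routePts c0 m pre cs ta i)) := by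
    refine Finset.prod_congr rfl fun i hi => ?_
    rw [Finset.mem_Icc] at hi
    rw [hpt i (by omega)]
  have hD : ∑ i ∈ Finset.Icc 1 (m + 1),
      D (routePts c0 m pre cs tb (i - 1)) (routePts c0 m pre cs tb i) = D0 := by
    rw [hD0]
    refine Finset.sum_congr rfl fun i hi => ?_
    rw [Finset.mem_Icc] at hi
    rw [hpt i (by omega), hpt (i - 1) (by omega)]
  have hsource : ∀ t, routePts c0 m pre cs t (m + 1) = cs := fun t => by simp [routePts]
  have hQpos : 0 < ∏ i ∈ Finset.Icc 1 m, (1 - P (routePts c0 m pre cs ta i)) := by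
    refine Finset.prod_pos fun i hi => ?_
    rw [Finset.mem_Icc] at hi
    have hi' : routePts c0 m pre cs ta i = pre (i - 1) := by
      rw [routePts, if_neg (by omega), if_pos hi.2]
    rw [hi', sub_pos]
    exact hpre_lt _ (by omega)
  rw [Froute_add, Froute_add, hF, hQ, hD, ← hD0]
  simp only [hsource, routePts_suffix]
  have hcs' : 0 < 1 - P cs := sub_pos.2 hcs
  have hDinf' : 0 < Dinf - D0 := sub_pos.2 hDinf
  gcongr ?_ + _ * ?_
  rcases hprec with ⟨h₁, h₂⟩ | ⟨h₁, h₂⟩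
  · linarith [mul_le_mul_of_nonneg_left h₁ hcs'.le, mul_lt_mul_of_pos_left h₂ hDinf']
  · linarith [mul_lt_mul_of_pos_left h₁ hcs', mul_le_mul_of_nonneg_left h₂ hDinf'.le]
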